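/- arXiv:2112.14859 — 3 statements merged into one kernel-verified Lean document; each statement's English description precedes it below -/
import Mathlib

section
/- Let f : ℂ → ℂ be infinitely differentiable in the real sense. For θ ∈ ℝ the integrand z ↦ (z·e^{−iθ})/(1 − z·e^{−iθ})·f(z) is integrable over the open unit disk {z ∈ ℂ : |z| < 1} with respect to Lebesgue measure, and the function u : ℝ → ℂ defined by u(θ) := ∫_{|z|<1} (z·e^{−iθ})/(1 − z·e^{−iθ})·f(z) dA(z) is infinitely differentiable on ℝ. -/
open MeasureTheory

/-- The integral of an integrable kernel against a smooth family of functions depends smoothly on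
the parameter. -/
theorem contDiff_setIntegral_mul_of_integrableOn {k : ℂ → ℂ} {s K : Set ℂ}
    (hk : IntegrableOn k s) (hs : MeasurableSet s) (hK : IsCompact K) (hsK : s ⊆ K)
    {G : ℝ × ℂ → ℂ} (hG : ContDiff ℝ (⊤ : ℕ∞) G) :
    ContDiff ℝ (⊤ : ℕ∞) (fun θ : ℝ => ∫ w in s, k w * G (θ, w)) := by
  have hasDeriv : ∀ {G : ℝ × ℂ → ℂ}, ContDiff ℝ (⊤ : ℕ∞) G → ∀ θ : ℝ,
      HasDerivAt (fun θ : ℝ => ∫ w in s, k w * G (θ, w))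
        (∫ w in s, k w * fderiv ℝ G (θ, w) (1, 0)) θ := by
    intro G hG θ
    have hG' : Continuous fun p => fderiv ℝ G p (1, 0) :=
      (hG.continuous_fderiv (by simp)).clm_apply continuous_const
    obtain ⟨C, hC⟩ := ((isCompact_closedBall θ 1).prod hK).exists_bound_of_continuousOn
      hG'.continuousOn
    have hGθ : Continuous fun w => G (θ, w) := hG.continuous.comp (Continuous.prodMk_right θ)
    obtain ⟨M, hM⟩ := hK.exists_bound_of_continuousOn hGθ.continuousOn
    refine (hasDerivAt_integral_of_dominated_loc_of_deriv_le
      (F := fun x w => k w * G (x, w)) (F' := fun x w => k w * fderiv ℝ G (x, w) (1, 0))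
      (bound := fun w => ‖k w‖ * C)
      (Metric.closedBall_mem_nhds θ one_pos) (.of_forall fun x => ?_) ?_ ?_ ?_ ?_ ?_).2
    · exact hk.aestronglyMeasurable.mul
        (hG.continuous.comp (Continuous.prodMk_right x)).aestronglyMeasurable
    · exact hk.mul_bdd hGθ.aestronglyMeasurable
        (ae_restrict_of_forall_mem hs fun w hw => hM w (hsK hw))
    · exact hk.aestronglyMeasurable.mul
        (hG'.comp (Continuous.prodMk_right θ)).aestronglyMeasurable
    · refine ae_restrict_of_forall_mem hs fun w hw x hx => ?_
      rw [norm_mul]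
      exact mul_le_mul_of_nonneg_left (hC (x, w) ⟨hx, hsK hw⟩) (norm_nonneg _)
    · exact hk.norm.mul_const C
    · refine .of_forall fun w x _ => HasDerivAt.const_mul _ ?_
      exact ((hG.differentiable (by simp) (x, w)).hasFDerivAt).comp_hasDerivAt x
        ((hasDerivAt_id x).prodMk (hasDerivAt_const x w))
  rw [contDiff_infty]
  intro n
  induction n generalizing G with
  | zero =>
    exact contDiff_zero.2 <| continuous_iff_continuousAt.2 fun θ => (hasDeriv hG θ).continuousAt
  | succ n ih =>
    push_cast
    refine contDiff_succ_iff_deriv.2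
      ⟨fun θ => (hasDeriv hG θ).differentiableAt, by simp, ?_⟩
    rw [funext fun θ => (hasDeriv hG θ).deriv]
    exact ih ((hG.fderiv_right (m := (⊤ : ℕ∞)) (by simp)).clm_apply contDiff_const)

/-- The function `z ↦ ‖z‖⁻¹` is integrable on balls of the plane. -/
theorem integrableOn_inv_norm_ball (R : ℝ) :
    IntegrableOn (fun z : ℂ => ‖z‖⁻¹) (Metric.ball 0 R) := by
  rw [integrableOn_fun_norm_addHaar volume (f := fun r : ℝ => r⁻¹), Complex.finrank_real_complex]
  refine (integrableOn_const (C := (1 : ℝ)) (by simp)).congr_fun (fun r hr => ?_) measurableSet_Ioo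
  simp [hr.1.ne']

theorem integrableOn_div_one_sub_ball :
    IntegrableOn (fun w : ℂ => w / (1 - w)) (Metric.ball 0 1) := by
  have hb : IntegrableOn (fun w : ℂ => ‖1 - w‖⁻¹) (Metric.ball 0 1) := by
    have h := (integrable_indicator_iff Metric.isOpen_ball.measurableSet).2
      (integrableOn_inv_norm_ball 2)
    refine (h.comp_sub_left 1).integrableOn.congr_fun (fun w hw => ?_)
      Metric.isOpen_ball.measurableSet
    refine Set.indicator_of_mem ?_ _
    rw [mem_ball_zero_iff] at hw ⊢
    linarith [norm_sub_le (1 : ℂ) w, norm_one (α := ℂ)]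
  refine Integrable.mono' hb (Measurable.aestronglyMeasurable (by fun_prop)) ?_
  refine ae_restrict_of_forall_mem Metric.isOpen_ball.measurableSet fun w hw => ?_
  rw [norm_div, div_eq_mul_inv]
  exact mul_le_of_le_one_left (by positivity) (mem_ball_zero_iff.1 hw).le

theorem stmt_6 (f : ℂ → ℂ) (hf : ContDiff ℝ (⊤ : ℕ∞) f) :
    (∀ θ : ℝ, IntegrableOn
      (fun z : ℂ =>
        z * Complex.exp (-(Complex.I * (θ : ℂ))) /
            (1 - z * Complex.exp (-(Complex.I * (θ : ℂ)))) * f z)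
      (Metric.ball 0 1) volume) ∧
    ContDiff ℝ (⊤ : ℕ∞) (fun θ : ℝ =>
      ∫ z in Metric.ball (0 : ℂ) 1,
        z * Complex.exp (-(Complex.I * (θ : ℂ))) /
            (1 - z * Complex.exp (-(Complex.I * (θ : ℂ)))) * f z) := by
  have hmp (θ : ℝ) := (rotation (Circle.exp θ)).measurePreserving
  have hemb (θ : ℝ) : MeasurableEmbedding (rotation (Circle.exp θ)) :=
    (rotation (Circle.exp θ)).toHomeomorph.measurableEmbedding
  have hpre (θ : ℝ) : rotation (Circle.exp θ) ⁻¹' Metric.ball 0 1 = Metric.ball 0 1 := by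
    rw [LinearIsometryEquiv.preimage_ball, map_zero]
  have hrot (θ : ℝ) (w : ℂ) :
      rotation (Circle.exp θ) w * Complex.exp (-(Complex.I * (θ : ℂ))) = w := by
    rw [rotation_apply, Circle.coe_exp, mul_right_comm, ← Complex.exp_add]
    simp [mul_comm]
  constructor
  · intro θ
    rw [← (hmp θ).integrableOn_comp_preimage (hemb θ), hpre]
    simp only [Function.comp_def, hrot]
    have hc : Continuous fun w => f (rotation (Circle.exp θ) w) :=
      hf.continuous.comp (rotation (Circle.exp θ)).continuous
    obtain ⟨M, hM⟩ := (isCompact_closedBall (0 : ℂ) 1).exists_bound_of_continuousOn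
      hc.continuousOn
    exact integrableOn_div_one_sub_ball.mul_bdd hc.aestronglyMeasurable
      (ae_restrict_of_forall_mem Metric.isOpen_ball.measurableSet
        fun w hw => hM w (Metric.ball_subset_closedBall hw))
  · have hG : ContDiff ℝ (⊤ : ℕ∞)
        fun p : ℝ × ℂ => f (Complex.exp ((p.1 : ℂ) * Complex.I) * p.2) :=
      hf.comp (((Complex.ofRealCLM.contDiff.comp contDiff_fst).mul contDiff_const).cexp.mul
        contDiff_snd)
    convert contDiff_setIntegral_mul_of_integrableOn integrableOn_div_one_sub_ball
      Metric.isOpen_ball.measurableSet (isCompact_closedBall (0 : ℂ) 1)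
      Metric.ball_subset_closedBall hG using 2 with θ
    rw [← (hmp θ).setIntegral_preimage_emb (hemb θ), hpre]
    simp only [hrot]
    simp only [rotation_apply, Circle.coe_exp]
end

section
/- Let ρ : ℂ → ℝ be an infinitely differentiable compactly supported function with ∫_ℂ ρ dA = 1, let h : ℂ × ℂ → ℂ be twice continuously differentiable in the real sense, and let z ∈ ℂ. Then, as ε → 0⁺, ε^{−2} ∫_ℂ ∫_ℂ ∂ρ(u)·∂ρ(v)·h(z + εu, z + εv) dA(u) dA(v) converges to ∂₁∂₂h(z, z), where ∂₁ and ∂₂ denote the Wirtinger derivatives of h in its first and second argument respectively. -/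
open MeasureTheory

/-- The Wirtinger derivative `∂f(u) = (1/2)(Dₓf(u) − i·D_yf(u))` of a real-valued
function on `ℂ`. -/
noncomputable def wirtingerR (f : ℂ → ℝ) (u : ℂ) : ℂ :=
  (1 / 2 : ℂ) * ((fderiv ℝ f u 1 : ℂ) - Complex.I * (fderiv ℝ f u Complex.I : ℂ))

/-- The Wirtinger derivative `∂f(u) = (1/2)(Dₓf(u) − i·D_yf(u))` of a complex-valued
function on `ℂ`. -/
noncomputable def wirtingerC (f : ℂ → ℂ) (u : ℂ) : ℂ :=
  (1 / 2 : ℂ) * (fderiv ℝ f u 1 - Complex.I * fderiv ℝ f u Complex.I)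

/-- The Wirtinger derivative of a function on `ℂ × ℂ` in its first variable. -/
noncomputable def wirtingerFst (h : ℂ × ℂ → ℂ) (p : ℂ × ℂ) : ℂ :=
  wirtingerC (fun w => h (w, p.2)) p.1

/-- The Wirtinger derivative of a function on `ℂ × ℂ` in its second variable. -/
noncomputable def wirtingerSnd (h : ℂ × ℂ → ℂ) (p : ℂ × ℂ) : ℂ :=
  wirtingerC (fun w => h (p.1, w)) p.2

lemma wirtingerC_ofReal {f : ℂ → ℝ} (hf : Differentiable ℝ f) (u : ℂ) :
    wirtingerC (fun w => (f w : ℂ)) u = wirtingerR f u := by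
  have key : HasFDerivAt (fun w => (f w : ℂ)) (Complex.ofRealCLM.comp (fderiv ℝ f u)) u :=
    Complex.ofRealCLM.hasFDerivAt.comp u (hf u).hasFDerivAt
  simp [wirtingerC, wirtingerR, key.fderiv]

lemma wirtingerC_comp_affine {f : ℂ → ℂ} (hf : Differentiable ℝ f) (z : ℂ) (ε : ℝ) (u : ℂ) :
    wirtingerC (fun w => f (z + (ε : ℂ) * w)) u = ε * wirtingerC f (z + (ε : ℂ) * u) := by
  have inner : HasFDerivAt (fun w : ℂ => z + (ε : ℂ) * w) (ε • ContinuousLinearMap.id ℝ ℂ) u := by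
    simpa [Complex.real_smul] using
      ((hasFDerivAt_id (𝕜 := ℝ) u).const_smul ε).const_add z
  have key := (hf (z + (ε : ℂ) * u)).hasFDerivAt.comp u inner
  have key' : fderiv ℝ (fun w => f (z + (ε : ℂ) * w)) u = _ := key.fderiv
  simp only [wirtingerC, key', ContinuousLinearMap.comp_apply, _root_.smul_apply,
    ContinuousLinearMap.id_apply, map_smul]
  simp only [Complex.real_smul]
  ring

lemma continuous_wirtingerC {f : ℂ → ℂ} (hf : ContDiff ℝ 1 f) : Continuous (wirtingerC f) := by
  have := hf.continuous_fderiv one_ne_zero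
  unfold wirtingerC
  fun_prop

lemma HasCompactSupport.wirtingerC {f : ℂ → ℂ} (hf : HasCompactSupport f) :
    HasCompactSupport (wirtingerC f) := by
  refine (hf.fderiv (𝕜 := ℝ)).mono' fun u hu => subset_closure fun h0 => hu ?_
  simp [_root_.wirtingerC, h0]

lemma contDiff_wirtingerFst {h : ℂ × ℂ → ℂ} {m n : ℕ∞} (hh : ContDiff ℝ n h) (hmn : m + 1 ≤ n) :
    ContDiff ℝ m (wirtingerFst h) := by
  have hd : ∀ v : ℂ, ContDiff ℝ m
      (fun p : ℂ × ℂ => fderiv ℝ (fun w => h (w, p.2)) p.1 v) := fun v =>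
    ContDiff.fderiv_apply (f := fun (p : ℂ × ℂ) w => h (w, p.2)) (m := n)
      (by fun_prop) contDiff_fst contDiff_const (by exact_mod_cast hmn)
  exact contDiff_const.mul ((hd 1).sub (contDiff_const.mul (hd Complex.I)))

lemma contDiff_wirtingerSnd {h : ℂ × ℂ → ℂ} {m n : ℕ∞} (hh : ContDiff ℝ n h) (hmn : m + 1 ≤ n) :
    ContDiff ℝ m (wirtingerSnd h) := by
  have hd : ∀ v : ℂ, ContDiff ℝ m
      (fun p : ℂ × ℂ => fderiv ℝ (fun w => h (p.1, w)) p.2 v) := fun v =>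
    ContDiff.fderiv_apply (f := fun (p : ℂ × ℂ) w => h (p.1, w)) (m := n)
      (by fun_prop) contDiff_snd contDiff_const (by exact_mod_cast hmn)
  exact contDiff_const.mul ((hd 1).sub (contDiff_const.mul (hd Complex.I)))

/-- Integration by parts for the Wirtinger derivative. -/
lemma integral_wirtingerC_mul {f g : ℂ → ℂ} (hf : ContDiff ℝ 1 f) (hfs : HasCompactSupport f)
    (hg : ContDiff ℝ 1 g) :
    ∫ u, wirtingerC f u * g u = -∫ u, f u * wirtingerC g u := by
  have hf' := hf.continuous_fderiv one_ne_zero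
  have hg' := hg.continuous_fderiv one_ne_zero
  have hfg' : ∀ v, Integrable (fun u => f u * fderiv ℝ g u v) := fun v =>
    (hf.continuous.mul (by fun_prop)).integrable_of_hasCompactSupport hfs.mul_right
  have hf'g : ∀ v, Integrable (fun u => fderiv ℝ f u v * g u) := fun v =>
    (Continuous.mul (by fun_prop) hg.continuous).integrable_of_hasCompactSupport
      (hfs.fderiv_apply (𝕜 := ℝ) v).mul_right
  have hfg : Integrable (fun u => f u * g u) :=
    (hf.continuous.mul hg.continuous).integrable_of_hasCompactSupport hfs.mul_right
  have parts : ∀ v, ∫ u, f u * fderiv ℝ g u v = -∫ u, fderiv ℝ f u v * g u := fun v =>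
    integral_mul_fderiv_eq_neg_fderiv_mul_of_integrable (hf'g v) (hfg' v) hfg
      (fun u _ => hf.differentiable one_ne_zero u) (fun u _ => hg.differentiable one_ne_zero u)
  have hl : ∀ u, wirtingerC f u * g u =
      (1 / 2 : ℂ) * (fderiv ℝ f u 1 * g u - Complex.I * (fderiv ℝ f u Complex.I * g u)) :=
    fun u => by unfold wirtingerC; ring
  have hr : ∀ u, f u * wirtingerC g u =
      (1 / 2 : ℂ) * (f u * fderiv ℝ g u 1 - Complex.I * (f u * fderiv ℝ g u Complex.I)) :=
    fun u => by unfold wirtingerC; ring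
  simp only [hl, hr, integral_const_mul]
  rw [integral_sub (hf'g 1) ((hf'g _).const_mul _), integral_sub (hfg' 1) ((hfg' _).const_mul _),
    integral_const_mul, integral_const_mul, parts, parts]
  ring

lemma integral_wirtingerC_mul_comp_affine {f g : ℂ → ℂ} (hf : ContDiff ℝ 1 f)
    (hfs : HasCompactSupport f) (hg : ContDiff ℝ 1 g) (z : ℂ) (ε : ℝ) :
    ∫ u, wirtingerC f u * g (z + (ε : ℂ) * u) =
      -(ε * ∫ u, f u * wirtingerC g (z + (ε : ℂ) * u)) := by
  rw [integral_wirtingerC_mul hf hfs (g := fun u => g (z + (ε : ℂ) * u)) (by fun_prop),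
    ← integral_const_mul]
  congr 2 with u
  rw [wirtingerC_comp_affine (hg.differentiable one_ne_zero)]
  ring

lemma integrable_mul_mul_of_hasCompactSupport {f g : ℂ → ℂ} {F : ℂ × ℂ → ℂ} (hf : Continuous f)
    (hfs : HasCompactSupport f) (hg : Continuous g) (hgs : HasCompactSupport g)
    (hF : Continuous F) :
    Integrable (fun p : ℂ × ℂ => f p.1 * g p.2 * F p) (volume.prod volume) := by
  refine Continuous.integrable_of_hasCompactSupport (by fun_prop) ?_
  refine HasCompactSupport.intro (hfs.isCompact.prod hgs.isCompact) fun p hp => ?_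
  by_cases h1 : p.1 ∈ tsupport f
  · have h2 : p.2 ∉ tsupport g := fun h2 => hp ⟨h1, h2⟩
    simp [image_eq_zero_of_notMem_tsupport h2]
  · simp [image_eq_zero_of_notMem_tsupport h1]

lemma integral_wirtingerC_mul_wirtingerC {f g : ℂ → ℂ} (hf : ContDiff ℝ 1 f)
    (hfs : HasCompactSupport f) (hg : ContDiff ℝ 1 g) (hgs : HasCompactSupport g)
    {h : ℂ × ℂ → ℂ} (hh : ContDiff ℝ 2 h) (z w : ℂ) (ε : ℝ) :
    ∫ p : ℂ × ℂ, wirtingerC f p.1 * wirtingerC g p.2 * h (z + (ε : ℂ) * p.1, w + (ε : ℂ) * p.2)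
        ∂(volume.prod volume) =
      (ε : ℂ) ^ 2 * ∫ p : ℂ × ℂ, f p.1 * g p.2 *
        wirtingerFst (wirtingerSnd h) (z + (ε : ℂ) * p.1, w + (ε : ℂ) * p.2)
        ∂(volume.prod volume) := by
  have hS : ContDiff ℝ 1 (wirtingerSnd h) :=
    contDiff_wirtingerSnd (m := 1) (n := 2) hh (by norm_num)
  have hFS : Continuous (wirtingerFst (wirtingerSnd h)) :=
    (contDiff_wirtingerFst (m := 0) (n := 1) hS (by norm_num)).continuous
  have hSc := hS.continuous
  have hf' := continuous_wirtingerC hf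
  have hg' := continuous_wirtingerC hg
  have hhc := hh.continuous
  have hsnd : ∀ u, ∫ v, wirtingerC g v * h (z + (ε : ℂ) * u, w + (ε : ℂ) * v) =
      -(ε * ∫ v, g v * wirtingerSnd h (z + (ε : ℂ) * u, w + (ε : ℂ) * v)) := fun u => by
    simpa only [wirtingerSnd] using integral_wirtingerC_mul_comp_affine hg hgs
      (g := fun v => h (z + (ε : ℂ) * u, v)) ((hh.of_le one_le_two).comp (by fun_prop)) w ε
  have hfst : ∀ v, ∫ u, wirtingerC f u * wirtingerSnd h (z + (ε : ℂ) * u, w + (ε : ℂ) * v) =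
      -(ε * ∫ u, f u * wirtingerFst (wirtingerSnd h) (z + (ε : ℂ) * u, w + (ε : ℂ) * v)) :=
    fun v => by
    simpa only [wirtingerFst] using integral_wirtingerC_mul_comp_affine hf hfs
      (g := fun u => wirtingerSnd h (u, w + (ε : ℂ) * v)) (hS.comp (by fun_prop)) z ε
  have hsndProd :
      ∫ p : ℂ × ℂ, wirtingerC f p.1 * wirtingerC g p.2 *
          h (z + (ε : ℂ) * p.1, w + (ε : ℂ) * p.2) ∂(volume.prod volume) =
        -(ε * ∫ p : ℂ × ℂ, wirtingerC f p.1 * g p.2 *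
          wirtingerSnd h (z + (ε : ℂ) * p.1, w + (ε : ℂ) * p.2) ∂(volume.prod volume)) := by
    rw [integral_prod _ (integrable_mul_mul_of_hasCompactSupport hf' hfs.wirtingerC hg'
        hgs.wirtingerC (by fun_prop)),
      integral_prod _ (integrable_mul_mul_of_hasCompactSupport hf' hfs.wirtingerC hg.continuous
        hgs (by fun_prop)), ← integral_const_mul, ← integral_neg]
    simp only [mul_assoc, integral_const_mul, hsnd]
    congr 1 with u
    ring
  have hfstProd :
      ∫ p : ℂ × ℂ, wirtingerC f p.1 * g p.2 *
          wirtingerSnd h (z + (ε : ℂ) * p.1, w + (ε : ℂ) * p.2) ∂(volume.prod volume) =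
        -(ε * ∫ p : ℂ × ℂ, f p.1 * g p.2 *
          wirtingerFst (wirtingerSnd h) (z + (ε : ℂ) * p.1, w + (ε : ℂ) * p.2)
          ∂(volume.prod volume)) := by
    rw [integral_prod_symm _ (integrable_mul_mul_of_hasCompactSupport hf' hfs.wirtingerC
        hg.continuous hgs (by fun_prop)),
      integral_prod_symm _ (integrable_mul_mul_of_hasCompactSupport hf.continuous hfs
        hg.continuous hgs (by fun_prop)), ← integral_const_mul, ← integral_neg]
    simp only [mul_comm _ (g _), mul_assoc, integral_const_mul, hfst]
    congr 1 with v
    ring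
  rw [hsndProd, hfstProd]
  ring

lemma continuous_integral_mul_mul_dilation {f g : ℂ → ℂ} {F : ℂ × ℂ → ℂ} (hf : Continuous f)
    (hfs : HasCompactSupport f) (hg : Continuous g) (hgs : HasCompactSupport g)
    (hF : Continuous F) (z w : ℂ) :
    Continuous fun ε : ℝ => ∫ p : ℂ × ℂ,
      f p.1 * g p.2 * F (z + (ε : ℂ) * p.1, w + (ε : ℂ) * p.2) ∂(volume.prod volume) := by
  have key := continuous_parametric_integral_of_continuous (μ := volume.prod volume)
    (f := fun (ε : ℝ) (p : ℂ × ℂ) =>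
      f p.1 * g p.2 * F (z + (ε : ℂ) * p.1, w + (ε : ℂ) * p.2))
    (by unfold Function.uncurry; fun_prop) (hfs.isCompact.prod hgs.isCompact)
  convert key using 2 with ε
  refine (setIntegral_eq_integral_of_forall_compl_eq_zero fun p hp => ?_).symm
  by_cases h1 : p.1 ∈ tsupport f
  · have h2 : p.2 ∉ tsupport g := fun h2 => hp ⟨h1, h2⟩
    simp [image_eq_zero_of_notMem_tsupport h2]
  · simp [image_eq_zero_of_notMem_tsupport h1]

theorem stmt_9 (ρ : ℂ → ℝ) (hρ : ContDiff ℝ (⊤ : ℕ∞) ρ) (hsupp : HasCompactSupport ρ)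
    (hnorm : (∫ u, ρ u) = 1)
    (h : ℂ × ℂ → ℂ) (hh : ContDiff ℝ 2 h) (z : ℂ) :
    Filter.Tendsto
      (fun ε : ℝ => ((ε : ℂ) ^ 2)⁻¹ *
        ∫ p : ℂ × ℂ,
          wirtingerR ρ p.1 * wirtingerR ρ p.2 * h (z + (ε : ℂ) * p.1, z + (ε : ℂ) * p.2)
          ∂(volume.prod volume))
      (nhdsWithin 0 (Set.Ioi 0))
      (nhds (wirtingerC (fun w => wirtingerC (fun w' => h (w, w')) z) z)) := by
  have hρd : Differentiable ℝ ρ := hρ.differentiable (by simp)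
  have hf : ContDiff ℝ 1 (fun u => (ρ u : ℂ)) :=
    Complex.ofRealCLM.contDiff.comp (hρ.of_le (by exact_mod_cast le_top))
  have hfs : HasCompactSupport (fun u => (ρ u : ℂ)) := hsupp.comp_left Complex.ofReal_zero
  have hFS : Continuous (wirtingerFst (wirtingerSnd h)) :=
    (contDiff_wirtingerFst (m := 0) (n := 1)
      (contDiff_wirtingerSnd (m := 1) (n := 2) hh (by norm_num)) (by norm_num)).continuous
  have hcont := (continuous_integral_mul_mul_dilation hf.continuous hfs hf.continuous hfs
    hFS z z).tendsto 0
  have hzero : ∫ p : ℂ × ℂ, (ρ p.1 : ℂ) * (ρ p.2 : ℂ) *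
      wirtingerFst (wirtingerSnd h) (z + ((0 : ℝ) : ℂ) * p.1, z + ((0 : ℝ) : ℂ) * p.2)
      ∂(volume.prod volume) = wirtingerFst (wirtingerSnd h) (z, z) := by
    simp only [Complex.ofReal_zero, zero_mul, add_zero]
    rw [integral_mul_const, integral_prod_mul (fun u => (ρ u : ℂ)) (fun u => (ρ u : ℂ)),
      integral_complex_ofReal, hnorm]
    simp
  rw [hzero] at hcont
  refine (hcont.mono_left nhdsWithin_le_nhds).congr' ?_
  filter_upwards [self_mem_nhdsWithin] with ε hε
  have hε0 : (ε : ℂ) ≠ 0 := Complex.ofReal_ne_zero.2 (ne_of_gt hε)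
  simp only [← wirtingerC_ofReal hρd]
  rw [integral_wirtingerC_mul_wirtingerC hf hfs hf hfs hh, inv_mul_cancel_left₀ (pow_ne_zero 2 hε0)]
end

section
/- Let n ≥ 1, let 0 < δ₁ < δ₂ < ⋯ < δₙ be real numbers, let p₁, …, pₙ ∈ ℤ, and let e_{ij} ∈ ℕ for 1 ≤ i < j ≤ n. If ∑_{i=1}^n pᵢ + ∑_{1≤i<j≤n} e_{ij} ≠ n, then ∫_{[0,2π]^n} ( ∏_{1≤i<j≤n} (δᵢ·e^{iθᵢ} − δⱼ·e^{iθⱼ})^{−e_{ij}} ) · ( ∏_{i=1}^n (δᵢ·e^{iθᵢ})^{1−pᵢ} ) dθ₁⋯dθₙ = 0. (The integrand is well defined and continuous since the radii are positive and pairwise distinct, so δᵢ·e^{iθᵢ} ≠ δⱼ·e^{iθⱼ} for i ≠ j and δᵢ·e^{iθᵢ} ≠ 0.) -/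
open MeasureTheory

theorem zpow_sum_eq_prod_zpow {ι G : Type*} [CommGroupWithZero G] {c : G} (hc : c ≠ 0)
    (s : Finset ι) (g : ι → ℤ) : c ^ ∑ i ∈ s, g i = ∏ i ∈ s, c ^ g i := by
  classical
  induction s using Finset.induction_on with
  | empty => simp
  | insert a s ha ih => rw [Finset.sum_insert ha, Finset.prod_insert ha, zpow_add₀ hc, ih]

/-- The integral over the box `[0, 2π]^ι` of a function of the `exp (I θᵢ)` is an integral over the
torus. -/
theorem setIntegral_pi_Icc_comp_exp {ι : Type*} [Fintype ι] [Fact (0 < 2 * Real.pi)]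
    {f : (ι → ℂ) → ℂ} (hf : Measurable f) :
    ∫ θ in Set.univ.pi fun _ : ι => Set.Icc (0 : ℝ) (2 * Real.pi),
      f (fun i => Complex.exp (Complex.I * (θ i : ℂ))) =
    ∫ x : ι → AddCircle (2 * Real.pi), f (fun i => (AddCircle.toCircle (x i) : ℂ)) := by
  have hmp : MeasurePreserving
      (fun (θ : ι → ℝ) (i : ι) => ((θ i : ℝ) : AddCircle (2 * Real.pi)))
      (Measure.pi fun _ : ι => volume.restrict (Set.Icc (0 : ℝ) (2 * Real.pi))) volume := by
    refine measurePreserving_pi _ _ fun _ => ?_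
    have h := AddCircle.measurePreserving_mk (2 * Real.pi) 0
    rwa [zero_add, restrict_Ioc_eq_restrict_Icc] at h
  have hmeas : Measurable fun x : ι → AddCircle (2 * Real.pi) =>
      f (fun i => (AddCircle.toCircle (x i) : ℂ)) := by
    refine hf.comp (measurable_pi_lambda _ fun i => ?_)
    exact (continuous_subtype_val.comp
      (AddCircle.continuous_toCircle.comp (continuous_apply i))).measurable
  rw [volume_pi, Measure.restrict_pi_pi, ← hmp.map_eq,
    integral_map hmp.aemeasurable hmeas.aestronglyMeasurable]
  refine integral_congr_ae (.of_forall fun θ => ?_)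
  simp only [AddCircle.toCircle_apply_mk, Circle.coe_exp]
  congr 1
  funext i
  rw [div_self Real.two_pi_pos.ne', one_mul, mul_comm]

/-- A function on the torus that is homogeneous of nonzero degree under the diagonal circle action
has vanishing integral. -/
theorem setIntegral_pi_Icc_comp_exp_eq_zero {ι : Type*} [Fintype ι] {f : (ι → ℂ) → ℂ}
    (hf : Measurable f) {N : ℤ} (hN : N ≠ 0)
    (hhom : ∀ c : ℂ, c ≠ 0 → ∀ z, f (fun i => c * z i) = c ^ N * f z) :
    ∫ θ in Set.univ.pi fun _ : ι => Set.Icc (0 : ℝ) (2 * Real.pi),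
      f (fun i => Complex.exp (Complex.I * (θ i : ℂ))) = 0 := by
  have : Fact (0 < 2 * Real.pi) := ⟨Real.two_pi_pos⟩
  rw [setIntegral_pi_Icc_comp_exp hf]
  set t : AddCircle (2 * Real.pi) := ((Real.pi / N : ℝ) : AddCircle (2 * Real.pi)) with ht
  have hc : (AddCircle.toCircle t : ℂ) ^ N = -1 := by
    have hN' : (N : ℂ) ≠ 0 := by exact_mod_cast hN
    rw [ht, AddCircle.toCircle_apply_mk, Circle.coe_exp, ← Complex.exp_int_mul,
      div_self Real.two_pi_pos.ne', one_mul, ← Complex.exp_pi_mul_I]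
    congr 1
    push_cast
    field_simp
  have hshift := integral_add_left_eq_self (μ := (volume : Measure (ι → AddCircle (2 * Real.pi))))
    (fun x => f (fun i => (AddCircle.toCircle (x i) : ℂ))) (fun _ => t)
  simp only [Pi.add_apply, AddCircle.toCircle_add, Circle.coe_mul,
    hhom _ (Circle.coe_ne_zero _), hc, neg_one_mul, integral_neg] at hshift
  exact self_eq_neg.mp hshift.symm

theorem stmt_13 (n : ℕ) (hn : 1 ≤ n) (δ : Fin n → ℝ) (hδpos : ∀ i, 0 < δ i)
    (hδmono : StrictMono δ) (p : Fin n → ℤ) (e : Fin n → Fin n → ℕ)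
    (hsum : (∑ i, p i) + (∑ i, ∑ j, if i < j then (e i j : ℤ) else 0) ≠ (n : ℤ)) :
    ∫ θ in Set.univ.pi fun _ : Fin n => Set.Icc (0 : ℝ) (2 * Real.pi),
      (∏ i, ∏ j, if i < j then
          ((δ i : ℂ) * Complex.exp (Complex.I * (θ i : ℂ)) -
              (δ j : ℂ) * Complex.exp (Complex.I * (θ j : ℂ))) ^ (-(e i j : ℤ))
        else 1) *
      ∏ i, ((δ i : ℂ) * Complex.exp (Complex.I * (θ i : ℂ))) ^ (1 - p i) = 0 := by
  refine setIntegral_pi_Icc_comp_exp_eq_zero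
    (f := fun z => (∏ i, ∏ j, if i < j then
        ((δ i : ℂ) * z i - (δ j : ℂ) * z j) ^ (-(e i j : ℤ)) else 1) *
      ∏ i, ((δ i : ℂ) * z i) ^ (1 - p i))
    (N := (∑ i, ∑ j, if i < j then -(e i j : ℤ) else 0) + ∑ i, (1 - p i)) ?_ ?_ ?_
  · refine .mul (Finset.measurable_prod _ fun i _ => Finset.measurable_prod _ fun j _ => ?_)
      (Finset.measurable_prod _ fun i _ => ?_)
    · split_ifs
      · exact Measurable.pow_const (by fun_prop) _
      · exact measurable_const
    · exact Measurable.pow_const (by fun_prop) _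
  · have hneg : (∑ i, ∑ j, if i < j then -(e i j : ℤ) else 0) =
        -∑ i, ∑ j, if i < j then (e i j : ℤ) else 0 := by
      simp only [← Finset.sum_neg_distrib, apply_ite Neg.neg, neg_zero]
    rw [hneg, Finset.sum_sub_distrib]
    simp only [Finset.sum_const, Finset.card_univ, Fintype.card_fin, nsmul_eq_mul, mul_one]
    omega
  · intro c hc z
    simp only [zpow_add₀ hc, zpow_sum_eq_prod_zpow hc]
    rw [mul_mul_mul_comm]
    simp only [← Finset.prod_mul_distrib]
    refine Finset.prod_congr rfl fun i _ => congrArg₂ _ (Finset.prod_congr rfl fun j _ => ?_) ?_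
    · split_ifs
      · rw [← mul_zpow, mul_sub, mul_left_comm, mul_left_comm (δ j : ℂ)]
      · simp
    · rw [← mul_zpow, mul_left_comm]
end
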